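/- Let V and U be locally finite h-modules and give V ⊗ U the diagonal h-action ρ(y)(v ⊗ u) = ρ(y)v ⊗ u + v ⊗ ρ(y)u. Then for every x ∈ h, the generalized eigenspace (V ⊗ U)_x equals the sum, over all pairs (y,z) ∈ h × h with y + z = x, of the images of V_y ⊗ U_z in V ⊗ U. -/

import Mathlib

open TensorProduct

namespace Module.End

section CommRing

variable {R M : Type*} [CommRing R] [AddCommGroup M] [Module R M]

lemma maxGenEigenspace_inf_le_add {f g : End R M} (hfg : Commute f g) (a b : R) :
    f.maxGenEigenspace a ⊓ g.maxGenEigenspace b ≤ (f + g).maxGenEigenspace (a + b) := by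
  rintro m ⟨hf, hg⟩
  obtain ⟨k, hk⟩ := (mem_maxGenEigenspace f a m).mp hf
  obtain ⟨l, hl⟩ := (mem_maxGenEigenspace g b m).mp hg
  have hcomm : Commute (f - a • (1 : End R M)) (g - b • (1 : End R M)) :=
    (hfg.sub_right ((Commute.one_right f).smul_right b)).sub_left
      (((Commute.one_left g).smul_left a).sub_right
        (((Commute.one_left (1 : End R M)).smul_left a).smul_right b))
  rw [mem_maxGenEigenspace]
  refine ⟨k + l - 1, ?_⟩
  have hsum : f + g - (a + b) • (1 : End R M) =
      (f - a • (1 : End R M)) + (g - b • (1 : End R M)) := by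
    rw [add_smul]; abel
  rw [hsum, hcomm.add_pow', LinearMap.sum_apply]
  refine Finset.sum_eq_zero fun ij hij ↦ ?_
  rw [LinearMap.smul_apply]
  rcases Nat.le_or_le_of_add_eq_add_pred (Finset.HasAntidiagonal.mem_antidiagonal.mp hij) with hi | hj
  · rw [(hcomm.pow_pow _ _).eq, mul_apply, pow_map_zero_of_le hi hk, map_zero, smul_zero]
  · rw [mul_apply, pow_map_zero_of_le hj hl, map_zero, smul_zero]

lemma maxGenEigenspace_le_smul (f : End R M) (a c : R) :
    f.maxGenEigenspace a ≤ (c • f).maxGenEigenspace (c * a) := by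
  intro m hm
  obtain ⟨k, hk⟩ := (mem_maxGenEigenspace f a m).mp hm
  rw [mem_maxGenEigenspace]
  refine ⟨k, ?_⟩
  rw [mul_smul, ← smul_sub, smul_pow, LinearMap.smul_apply, hk, smul_zero]

/-- For a linear family of commuting endomorphisms, being a simultaneous generalised eigenvector
with linear eigenvalue `χ` can be tested on a spanning family. -/
lemma mem_iInf_maxGenEigenspace_of_span_eq_top {L ι : Type*} [AddCommGroup L] [Module R L]
    (ρ : L →ₗ[R] End R M) (hρ : ∀ y z, Commute (ρ y) (ρ z)) (χ : L →ₗ[R] R) {b : ι → L}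
    (hb : Submodule.span R (Set.range b) = ⊤) {m : M}
    (hm : ∀ i, m ∈ (ρ (b i)).maxGenEigenspace (χ (b i))) :
    m ∈ ⨅ y, (ρ y).maxGenEigenspace (χ y) := by
  refine (Submodule.mem_iInf _).mpr fun y ↦ ?_
  have hy : y ∈ Submodule.span R (Set.range b) := hb ▸ Submodule.mem_top
  induction hy using Submodule.span_induction with
  | mem y hy => obtain ⟨i, rfl⟩ := hy; exact hm i
  | zero => exact (mem_maxGenEigenspace _ _ _).mpr ⟨1, by simp⟩
  | add y z _ _ hy hz =>
    rw [map_add, map_add]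
    exact maxGenEigenspace_inf_le_add (hρ y z) _ _ ⟨hy, hz⟩
  | smul c y _ hy =>
    rw [map_smul, map_smul, smul_eq_mul]
    exact maxGenEigenspace_le_smul _ _ _ hy

lemma map₂_mk_maxGenEigenspace_le {N : Type*} [AddCommGroup N] [Module R N]
    (f : End R M) (g : End R N) (a b : R) :
    Submodule.map₂ (TensorProduct.mk R M N) (f.maxGenEigenspace a) (g.maxGenEigenspace b) ≤
      maxGenEigenspace (f.rTensor N + g.lTensor M) (a + b) := by
  rw [Submodule.map₂_le]
  intro m hm n hn
  obtain ⟨k, hk⟩ := (mem_maxGenEigenspace f a m).mp hm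
  obtain ⟨l, hl⟩ := (mem_maxGenEigenspace g b n).mp hn
  have hcomm : Commute (f.rTensor N) (g.lTensor M) := by
    ext; simp
  refine maxGenEigenspace_inf_le_add hcomm a b ⟨?_, ?_⟩
  · refine (mem_maxGenEigenspace _ _ _).mpr ⟨k, ?_⟩
    have : f.rTensor N - a • (1 : End R (M ⊗[R] N)) = (f - a • (1 : End R M)).rTensor N := by
      ext; simp [smul_tmul']
    rw [this, LinearMap.rTensor_pow, mk_apply, LinearMap.rTensor_tmul, hk, zero_tmul]
  · refine (mem_maxGenEigenspace _ _ _).mpr ⟨l, ?_⟩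
    have : g.lTensor M - b • (1 : End R (M ⊗[R] N)) = (g - b • (1 : End R N)).lTensor M := by
      ext; simp
    rw [this, LinearMap.lTensor_pow, mk_apply, LinearMap.lTensor_tmul, hl, tmul_zero]

lemma eq_iInf_maxGenEigenspace_of_mem_iff {L : Type*} [AddCommGroup L] [Module R L]
    (B : L →ₗ[R] L →ₗ[R] R) (ρ : L →ₗ[R] End R M) (E : L → Submodule R M)
    (hE : ∀ (x : L) (m : M), m ∈ E x ↔
      ∀ y : L, ∃ n : ℕ, 1 ≤ n ∧ ((ρ y - B y x • (1 : End R M)) ^ n) m = 0) :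
    E = fun x ↦ ⨅ y, (ρ y).maxGenEigenspace (B y x) := by
  funext x
  ext m
  simp only [hE, Submodule.mem_iInf, mem_maxGenEigenspace]
  refine forall_congr' fun y ↦ ⟨fun ⟨n, _, hn⟩ ↦ ⟨n, hn⟩, fun ⟨n, hn⟩ ↦ ⟨n + 1, by simp, ?_⟩⟩
  exact pow_map_zero_of_le n.le_succ hn

end CommRing

section Field

variable {K M : Type*} [Field K] [IsAlgClosed K] [AddCommGroup M] [Module K M]

lemma mem_iSup_inf_maxGenEigenspace_of_aeval_eq_zero (f : End K M) {p : Submodule K M}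
    (hp : ∀ m ∈ p, f m ∈ p) {q : Polynomial K} (hq : q ≠ 0) {m : M} (hm : m ∈ p)
    (hqm : Polynomial.aeval f q m = 0) :
    m ∈ ⨆ μ, p ⊓ f.maxGenEigenspace μ := by
  induction q using UniqueFactorizationMonoid.induction_on_coprime generalizing m with
  | h0 => exact absurd rfl hq
  | h1 hu =>
    obtain ⟨u, rfl⟩ := hu
    have : m =
        Polynomial.aeval f (((u⁻¹ : (Polynomial K)ˣ) : Polynomial K) * (u : Polynomial K)) m := by simp
    rw [this, map_mul, mul_apply, hqm, map_zero]
    exact zero_mem _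
  | @hpr r i hr =>
    obtain ⟨μ, hμ⟩ := IsAlgClosed.exists_root r
      (Polynomial.degree_pos_of_irreducible hr.irreducible).ne'
    obtain ⟨c, hc⟩ := ((Polynomial.irreducible_X_sub_C μ).associated_of_dvd hr.irreducible
      (Polynomial.dvd_iff_isRoot.mpr hμ)).symm.pow_pow (n := i)
    refine Submodule.mem_iSup_of_mem μ ⟨hm, (mem_maxGenEigenspace _ _ _).mpr ⟨i, ?_⟩⟩
    have : f - μ • (1 : End K M) = Polynomial.aeval f (Polynomial.X - Polynomial.C μ) := by
      simp [Algebra.algebraMap_eq_smul_one]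
    rw [this, ← map_pow, ← hc, mul_comm, map_mul, mul_apply, hqm, map_zero]
  | @hcp r s hrs hr hs =>
    obtain ⟨u, v, huv⟩ := hrs.isCoprime
    have hmem (t : Polynomial K) : Polynomial.aeval f t m ∈ p := by
      exact Polynomial.aeval_apply_smul_mem_of_le_comap' hm t f hp
    have : m = Polynomial.aeval f (u * r) m + Polynomial.aeval f (v * s) m := by
      rw [← LinearMap.add_apply, ← map_add, huv]; simp
    rw [this]
    refine add_mem (hs (right_ne_zero_of_mul hq) (hmem _) ?_)
      (hr (left_ne_zero_of_mul hq) (hmem _) ?_)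
    · rw [← mul_apply, ← map_mul, show s * (u * r) = u * (r * s) by ring, map_mul, mul_apply,
        hqm, map_zero]
    · rw [← mul_apply, ← map_mul, show r * (v * s) = v * (r * s) by ring, map_mul, mul_apply,
        hqm, map_zero]

/-- Finitely many commuting locally finite endomorphisms are simultaneously triangularizable. -/
lemma iSup_biInf_maxGenEigenspace_eq_top {ι : Type*} (f : ι → End K M)
    (hf : ∀ i j, Commute (f i) (f j))
    (hlf : ∀ i m, ∃ q : Polynomial K, q ≠ 0 ∧ Polynomial.aeval (f i) q m = 0) (s : Finset ι) :
    ⨆ χ : ι → K, ⨅ i ∈ s, (f i).maxGenEigenspace (χ i) = ⊤ := by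
  classical
  induction s using Finset.induction_on with
  | empty => simp
  | insert j s hj ih =>
    rw [eq_top_iff, ← ih]
    refine iSup_le fun χ m hm ↦ ?_
    have hinv : ∀ n ∈ ⨅ i ∈ s, (f i).maxGenEigenspace (χ i),
        f j n ∈ ⨅ i ∈ s, (f i).maxGenEigenspace (χ i) := by
      intro n hn
      simp only [Submodule.mem_iInf] at hn ⊢
      exact fun i hi ↦ mapsTo_maxGenEigenspace_of_comm (hf i j) _ (hn i hi)
    obtain ⟨q, hq, hqm⟩ := hlf j m
    refine SetLike.le_def.mp (iSup_le fun μ ↦ ?_)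
      (mem_iSup_inf_maxGenEigenspace_of_aeval_eq_zero (f j) hinv hq hm hqm)
    refine le_trans ?_ (le_iSup _ (Function.update χ j μ))
    rw [Finset.iInf_insert, Function.update_self, inf_comm]
    refine inf_le_inf_left _ (iInf₂_mono fun i hi ↦ ?_)
    rw [Function.update_of_ne (ne_of_mem_of_not_mem hi hj)]

end Field

end Module.End

lemma iSupIndep.eq_of_le_of_iSup_eq_top {ι α : Type*} [CompleteLattice α] [IsModularLattice α]
    {s t : ι → α} (ht : iSupIndep t) (hst : s ≤ t) (hs : ⨆ i, s i = ⊤) : s = t := by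
  refine funext fun i ↦ le_antisymm (hst i) ?_
  have hdisj : t i ⊓ ⨆ (j) (_ : j ≠ i), s j = ⊥ :=
    ((ht i).mono_right (iSup₂_mono fun j _ ↦ hst j)).eq_bot
  have htop : s i ⊔ ⨆ (j) (_ : j ≠ i), s j = ⊤ := by
    rw [← hs, iSup_split_single s i]
  calc t i = (s i ⊔ ⨆ (j) (_ : j ≠ i), s j) ⊓ t i := by rw [htop, top_inf_eq]
    _ = s i ⊔ (⨆ (j) (_ : j ≠ i), s j) ⊓ t i := sup_inf_assoc_of_le _ (hst i)
    _ ≤ s i := by rw [inf_comm, hdisj, sup_bot_eq]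

lemma iSup_iInf_maxGenEigenspace_bilin_eq_top {K L M : Type*} [Field K] [IsAlgClosed K]
    [AddCommGroup L] [Module K L] [FiniteDimensional K L] [AddCommGroup M] [Module K M]
    (B : L →ₗ[K] L →ₗ[K] K) (hB : Function.Surjective B.flip)
    (ρ : L →ₗ[K] Module.End K M) (hρ : ∀ y z, Commute (ρ y) (ρ z))
    (hlf : ∀ y m, ∃ q : Polynomial K, q ≠ 0 ∧ Polynomial.aeval (ρ y) q m = 0) :
    ⨆ x, ⨅ y, (ρ y).maxGenEigenspace (B y x) = ⊤ := by
  let b := Module.finBasis K L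
  rw [eq_top_iff, ← Module.End.iSup_biInf_maxGenEigenspace_eq_top (fun i ↦ ρ (b i))
    (fun i j ↦ hρ _ _) (fun i m ↦ hlf _ m) Finset.univ]
  refine iSup_le fun χ m hm ↦ ?_
  obtain ⟨x, hx⟩ := hB (b.constr K χ)
  refine Submodule.mem_iSup_of_mem x
    (Module.End.mem_iInf_maxGenEigenspace_of_span_eq_top ρ hρ (B.flip x) b.span_eq fun i ↦ ?_)
  rw [hx, b.constr_basis]
  simp only [Submodule.mem_iInf] at hm
  exact hm i (Finset.mem_univ i)

/-- For locally finite modules `V`, `U` over the finite-dimensional abelian Lie algebra `h`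
(with nondegenerate symmetric bilinear form `B`), and the diagonal action on `V ⊗ U`,
the generalized eigenspace `(V ⊗ U)_x` equals the sum over pairs `(y,z)` with `y + z = x` of
the images of `V_y ⊗ U_z` in `V ⊗ U`. -/
theorem genEigenspace_tensorProduct
    (h : Type*) [AddCommGroup h] [Module ℂ h] [FiniteDimensional ℂ h]
    (B : h →ₗ[ℂ] h →ₗ[ℂ] ℂ)
    (hBsymm : ∀ x y : h, B x y = B y x)
    (hBnd : ∀ x : h, (∀ y : h, B x y = 0) → x = 0)
    (V : Type*) [AddCommGroup V] [Module ℂ V]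
    (U : Type*) [AddCommGroup U] [Module ℂ U]
    (ρV : h →ₗ[ℂ] Module.End ℂ V)
    (ρU : h →ₗ[ℂ] Module.End ℂ U)
    (hcommV : ∀ y z : h, Commute (ρV y) (ρV z))
    (hcommU : ∀ y z : h, Commute (ρU y) (ρU z))
    (hlfV : ∀ (y : h) (v : V), ∃ f : Polynomial ℂ, f ≠ 0 ∧ (Polynomial.aeval (ρV y) f) v = 0)
    (hlfU : ∀ (y : h) (u : U), ∃ f : Polynomial ℂ, f ≠ 0 ∧ (Polynomial.aeval (ρU y) f) u = 0)
    -- the diagonal action on `V ⊗ U`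
    (ρT : h →ₗ[ℂ] Module.End ℂ (V ⊗[ℂ] U))
    (hρT : ∀ (y : h) (v : V) (u : U), ρT y (v ⊗ₜ[ℂ] u) = (ρV y v) ⊗ₜ[ℂ] u + v ⊗ₜ[ℂ] (ρU y u))
    -- generalized eigenspaces
    (EV : h → Submodule ℂ V)
    (hEV : ∀ (x : h) (v : V), v ∈ EV x ↔
        ∀ y : h, ∃ n : ℕ, 1 ≤ n ∧ ((ρV y - B y x • (1 : Module.End ℂ V)) ^ n) v = 0)
    (EU : h → Submodule ℂ U)
    (hEU : ∀ (x : h) (u : U), u ∈ EU x ↔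
        ∀ y : h, ∃ n : ℕ, 1 ≤ n ∧ ((ρU y - B y x • (1 : Module.End ℂ U)) ^ n) u = 0)
    (ET : h → Submodule ℂ (V ⊗[ℂ] U))
    (hET : ∀ (x : h) (t : V ⊗[ℂ] U), t ∈ ET x ↔
        ∀ y : h, ∃ n : ℕ, 1 ≤ n ∧ ((ρT y - B y x • (1 : Module.End ℂ (V ⊗[ℂ] U))) ^ n) t = 0)
    (x : h) :
    ET x = ⨆ (p : h × h) (_ : p.1 + p.2 = x),
        Submodule.map₂ (TensorProduct.mk ℂ V U) (EV p.1) (EU p.2) := by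
  have hinj : Function.Injective B.flip := by
    refine (injective_iff_map_eq_zero B.flip).mpr fun z hz ↦ hBnd z fun y ↦ ?_
    rw [hBsymm, ← B.flip_apply, hz, LinearMap.zero_apply]
  have hsurj : Function.Surjective B.flip :=
    (LinearMap.injective_iff_surjective_of_finrank_eq_finrank
      (Subspace.dual_finrank_eq (K := ℂ) (V := h)).symm).mp hinj
  have hρT' (y : h) : ρT y = (ρV y).rTensor U + (ρU y).lTensor V := by
    ext v u; simp [hρT]
  have hcommT (y z : h) : Commute (ρT y) (ρT z) := by
    ext v u
    have hv := LinearMap.congr_fun (hcommV y z).eq v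
    have hu := LinearMap.congr_fun (hcommU y z).eq u
    simp only [Module.End.mul_apply] at hv hu
    simp only [AlgebraTensorModule.curry_apply, LinearMap.restrictScalars_self, curry_apply,
      Module.End.mul_apply, hρT, map_add, hv, hu]
    abel
  have hEVtop : ⨆ y, EV y = ⊤ := by
    rw [Module.End.eq_iInf_maxGenEigenspace_of_mem_iff B ρV EV hEV]
    exact iSup_iInf_maxGenEigenspace_bilin_eq_top B hsurj ρV hcommV hlfV
  have hEUtop : ⨆ y, EU y = ⊤ := by
    rw [Module.End.eq_iInf_maxGenEigenspace_of_mem_iff B ρU EU hEU]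
    exact iSup_iInf_maxGenEigenspace_bilin_eq_top B hsurj ρU hcommU hlfU
  have hindep : iSupIndep ET := by
    rw [Module.End.eq_iInf_maxGenEigenspace_of_mem_iff B ρT ET hET]
    refine (Module.End.independent_iInf_maxGenEigenspace_of_forall_mapsTo (fun y ↦ ρT y)
      fun i j φ ↦ Module.End.mapsTo_maxGenEigenspace_of_comm (hcommT j i) φ).comp
      (f := fun x y ↦ B y x) fun x x' hxx' ↦ hinj (LinearMap.ext fun y ↦ congr_fun hxx' y)
  refine (congr_fun (hindep.eq_of_le_of_iSup_eq_top (s := fun x ↦ ⨆ (p : h × h)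
    (_ : p.1 + p.2 = x), Submodule.map₂ (TensorProduct.mk ℂ V U) (EV p.1) (EU p.2)) ?_ ?_) x).symm
  · intro x
    refine iSup₂_le ?_
    rintro ⟨y, z⟩ rfl
    rw [Module.End.eq_iInf_maxGenEigenspace_of_mem_iff B ρT ET hET,
      Module.End.eq_iInf_maxGenEigenspace_of_mem_iff B ρV EV hEV,
      Module.End.eq_iInf_maxGenEigenspace_of_mem_iff B ρU EU hEU]
    refine le_iInf fun w ↦ ?_
    rw [map_add, hρT']
    exact (Submodule.map₂_le_map₂ (iInf_le _ w) (iInf_le _ w)).trans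
      (Module.End.map₂_mk_maxGenEigenspace_le _ _ _ _)
  · rw [eq_top_iff, ← TensorProduct.map₂_mk_top_top_eq_top, ← hEVtop, ← hEUtop,
      Submodule.map₂_iSup_left]
    simp_rw [Submodule.map₂_iSup_right]
    exact iSup₂_le fun y z ↦ le_iSup_of_le (y + z) (le_iSup₂_of_le (y, z) rfl le_rfl)
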